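/- Let G be a graph with at least one edge and let t = Xind(Hom(K_2, G)) + 2. For every independent representation (x_v) of G over a matroid M, there exist disjoint vertex sets X* of size ⌊t/2⌋ and Y* of size ⌈t/2⌉ such that G[X*, Y*] is complete bipartite, {x_v : v ∈ X*} is independent in M, and {x_v : v ∈ Y*} is independent in M. In particular, rk(M) ≥ t/2 + 1. -/

import Mathlib

/-- The underlying set of the free `Z₂`-poset `Q n`: the elements `±1, …, ±(n+1)`,
encoded as nonzero integers of absolute value at most `n + 1`. -/
def QElem (n : ℕ) : Type := {i : ℤ // i ≠ 0 ∧ |i| ≤ n + 1}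

/-- The partial order of `Q n`: `p < q` iff `|p| < |q|`. -/
instance (n : ℕ) : PartialOrder (QElem n) where
  le p q := p = q ∨ |p.1| < |q.1|
  le_refl p := Or.inl rfl
  le_trans p q r h1 h2 := by
    rcases h1 with rfl | h1
    · exact h2
    · rcases h2 with rfl | h2
      · exact Or.inr h1
      · exact Or.inr (h1.trans h2)
  le_antisymm p q h1 h2 := by
    rcases h1 with rfl | h1
    · rfl
    · rcases h2 with rfl | h2
      · rfl
      · exact absurd (h1.trans h2) (lt_irrefl _)

/-- The involution `i ↦ -i` of `Q n`. -/
def QNeg (n : ℕ) : QElem n → QElem n :=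
  fun p => ⟨-p.1, neg_ne_zero.mpr p.2.1, by rw [abs_neg]; exact p.2.2⟩

/-- An order-preserving `Z₂`-map between two posets equipped with involutions. -/
def IsZ2Map {P Q : Type*} [PartialOrder P] [PartialOrder Q] (νP : P → P) (νQ : Q → Q)
    (f : P → Q) : Prop :=
  Monotone f ∧ ∀ p, f (νP p) = νQ (f p)

open Classical in
/-- The cross-index of a free `Z₂`-poset `(P, ν)` : the minimum `n` such that there is an
order-preserving `Z₂`-map from `P` to `Q n`, with the convention `-1` for the empty poset. -/
noncomputable def XindZ (P : Type*) [PartialOrder P] (νP : P → P) : ℤ :=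
  if Nonempty P then ((sInf {n : ℕ | ∃ f : P → QElem n, IsZ2Map νP (QNeg n) f} : ℕ) : ℤ)
  else -1

/-- The Hom complex `Hom(K₂, G)`: pairs `(X, Y)` of nonempty disjoint vertex sets such that
`G[X, Y]` is complete bipartite, ordered by componentwise inclusion. -/
def HomK2 {V : Type*} (G : SimpleGraph V) : Type _ :=
  {XY : Set V × Set V // XY.1.Nonempty ∧ XY.2.Nonempty ∧ Disjoint XY.1 XY.2 ∧
    ∀ a ∈ XY.1, ∀ b ∈ XY.2, G.Adj a b}

instance {V : Type*} (G : SimpleGraph V) : PartialOrder (HomK2 G) :=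
  Subtype.partialOrder _

/-- The involution `(X, Y) ↦ (Y, X)` of the Hom complex. -/
def HomK2Swap {V : Type*} (G : SimpleGraph V) : HomK2 G → HomK2 G :=
  fun p => ⟨(p.1.2, p.1.1), p.2.2.1, p.2.1, p.2.2.2.1.symm,
    fun b hb a ha => (p.2.2.2.2 a ha b hb).symm⟩

/-- The rank of a matroid: the supremum of the cardinalities of its independent sets. -/
noncomputable def matroidRank {α : Type*} (M : Matroid α) : ℕ∞ :=
  ⨆ I : {I : Set α // M.Indep I}, I.1.encard

lemma exists_large_pair {V β : Type*} (G : SimpleGraph V) [Nonempty (HomK2 G)]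
    (r : Set V → ℕ) (c : Set V → β) (hr : Monotone r)
    (hc : ∀ S T, S ⊆ T → r S = r T → c S = c T)
    (hne : ∀ p : HomK2 G, c p.1.1 ≠ c p.1.2)
    (hpos : ∀ p : HomK2 G, 1 ≤ r p.1.1)
    (t : ℕ) (ht : (t : ℤ) = XindZ (HomK2 G) (HomK2Swap G) + 2) :
    ∃ p : HomK2 G, t / 2 ≤ r p.1.1 ∧ t - t / 2 ≤ r p.1.2 := by
  classical
  by_contra! hcon
  have hpos2 : ∀ p : HomK2 G, 1 ≤ r p.1.2 := fun p => hpos (HomK2Swap G p)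
  have hcon2 : ∀ p : HomK2 G, t / 2 ≤ r p.1.2 → r p.1.1 < t - t / 2 :=
    fun p => hcon (HomK2Swap G p)
  have p0 : HomK2 G := Classical.arbitrary _
  have ht3 : 3 ≤ t := by
    have h1 := hcon p0
    have h2 := hpos p0
    have h3 := hpos2 p0
    unfold XindZ at ht
    rw [if_pos (inferInstanceAs (Nonempty (HomK2 G)))] at ht
    omega
  let lv : HomK2 G → ℕ := fun p =>
    min (2 * min (r p.1.1) (r p.1.2) + 1) (r p.1.1 + r p.1.2)
  have hlv2 : ∀ p, 2 ≤ lv p := by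
    intro p
    have h2 := hpos p
    have h3 := hpos2 p
    simp only [lv]
    omega
  have hlvt : ∀ p, lv p ≤ t - 1 := by
    intro p
    have h1 := hcon p
    have h2 := hcon2 p
    simp only [lv]
    omega
  let s : HomK2 G → Prop := fun p =>
    r p.1.1 < r p.1.2 ∨ (r p.1.1 = r p.1.2 ∧ WellOrderingRel (c p.1.1) (c p.1.2))
  have hs : ∀ p, s (HomK2Swap G p) ↔ ¬ s p := by
    intro p
    change (r p.1.2 < r p.1.1 ∨ (r p.1.2 = r p.1.1 ∧ WellOrderingRel (c p.1.2) (c p.1.1))) ↔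
      ¬ (r p.1.1 < r p.1.2 ∨ (r p.1.1 = r p.1.2 ∧ WellOrderingRel (c p.1.1) (c p.1.2)))
    have htri : WellOrderingRel (c p.1.2) (c p.1.1) ↔ ¬ WellOrderingRel (c p.1.1) (c p.1.2) := by
      constructor
      · intro h h'
        exact asymm_of WellOrderingRel h h'
      · intro h
        rcases trichotomous_of WellOrderingRel (c p.1.1) (c p.1.2) with h' | h' | h'
        · exact absurd h' h
        · exact absurd h' (hne p)
        · exact h'
    rw [htri]
    rcases lt_trichotomy (r p.1.1) (r p.1.2) with h | h | h
    · have h1 := h.ne'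
      have h2 := h.not_gt
      tauto
    · rw [h]; simp
    · have h1 := h.ne'
      have h2 := h.not_gt
      tauto
  let g : HomK2 G → ℤ := fun p => if s p then (lv p : ℤ) - 1 else -((lv p : ℤ) - 1)
  have hgabs : ∀ p, |g p| = (lv p : ℤ) - 1 := by
    intro p
    have := hlv2 p
    simp only [g]
    split_ifs
    · rw [abs_of_nonneg]; omega
    · rw [abs_neg, abs_of_nonneg]; omega
  have hlvswap : ∀ p, lv (HomK2Swap G p) = lv p := by
    intro p
    change min (2 * min (r p.1.2) (r p.1.1) + 1) (r p.1.2 + r p.1.1) =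
      min (2 * min (r p.1.1) (r p.1.2) + 1) (r p.1.1 + r p.1.2)
    omega
  let f : HomK2 G → QElem (t - 3) := fun p => ⟨g p, by
    have h2 := hlv2 p
    intro h
    have := hgabs p
    rw [h, abs_zero] at this
    omega, by
    have h2 := hlvt p
    rw [hgabs]
    omega⟩
  have hf : IsZ2Map (HomK2Swap G) (QNeg (t - 3)) f := by
    constructor
    · intro p q hpq
      have hX : p.1.1 ⊆ q.1.1 := hpq.1
      have hY : p.1.2 ⊆ q.1.2 := hpq.2
      have hrX := hr hX
      have hrY := hr hY
      have hle : lv p ≤ lv q := by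
        simp only [lv]
        omega
      rcases hle.lt_or_eq with hlt | heq
      · right
        change |g p| < |g q|
        rw [hgabs, hgabs]
        omega
      · left
        apply Subtype.ext
        change g p = g q
        have hst : s p ↔ s q := by
          simp only [lv] at heq
          simp only [s]
          by_cases hpe : r p.1.1 = r p.1.2
          · have e1 : r p.1.1 = r q.1.1 := by omega
            have e2 : r p.1.2 = r q.1.2 := by omega
            rw [hc _ _ hX e1, hc _ _ hY e2, e1, e2]
          · have : r q.1.1 ≠ r q.1.2 := by omega
            simp only [hpe, this, false_and, or_false]
            omega
        simp only [g, hst, heq]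
    · intro p
      apply Subtype.ext
      change g (HomK2Swap G p) = - g p
      simp only [g, hs, hlvswap]
      by_cases h : s p <;> simp [h]
  unfold XindZ at ht
  rw [if_pos (inferInstanceAs (Nonempty (HomK2 G)))] at ht
  have := Nat.sInf_le (s := {n : ℕ | ∃ f : HomK2 G → QElem n, IsZ2Map (HomK2Swap G) (QNeg n) f})
    (m := t - 3) ⟨f, hf⟩
  omega

lemma exists_indep_subset {V α : Type*} [Fintype V] (M : Matroid α) (x : V → α)
    (S : Set V) (k : ℕ) (hk : k ≤ (M.eRk (x '' S)).toNat) :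
    ∃ X : Finset V, (X : Set V) ⊆ S ∧ X.card = k ∧ Set.InjOn x X ∧ M.Indep (x '' X) := by
  classical
  have hk' : (k : ℕ∞) ≤ M.eRk (x '' S) :=
    (Nat.cast_le.2 hk).trans (ENat.natCast_toNat_le_self _)
  obtain ⟨I, hIS, hI, hIk⟩ := Matroid.le_eRk_iff.1 hk'
  obtain ⟨U, hUS, hU⟩ := Set.SurjOn.exists_bijOn_subset (f := x) (s := S) (t := I) hIS
  refine ⟨U.toFinset, by simpa using hUS, ?_, by simpa using hU.injOn, by
    simpa [hU.image_eq] using hI⟩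
  have h1 : U.encard = k := by
    rw [← hIk, ← hU.image_eq, hU.injOn.encard_image]
  have h2 : ((U.toFinset.card : ℕ) : ℕ∞) = k := by
    rw [← Set.encard_coe_eq_coe_finsetCard, Set.coe_toFinset, h1]
  exact_mod_cast h2

/-- Let `G` be a graph with at least one edge and
`t = Xind(Hom(K₂, G)) + 2`. For every independent representation `x` of `G` over a matroid
`M` (each `x v` lies in the ground set and is not in the closure of the elements assigned to
the neighbors of `v`), there are disjoint vertex sets `X` of size `⌊t/2⌋` and `Y` of size
`⌈t/2⌉` spanning a complete bipartite subgraph such that the elements assigned to `X` and to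
`Y` each form an independent set in `M`; in particular `rk M ≥ t/2 + 1`. -/
theorem matroid_independent_representation {V : Type*} [Fintype V] [DecidableEq V]
    (G : SimpleGraph V) {a b : V} (hab : G.Adj a b)
    (t : ℕ) (ht : (t : ℤ) = XindZ (HomK2 G) (HomK2Swap G) + 2)
    {α : Type*} (M : Matroid α) (x : V → α)
    (hxE : ∀ v, x v ∈ M.E)
    (hind : ∀ v, x v ∉ M.closure (x '' (G.neighborSet v))) :
    (∃ X Y : Finset V, Disjoint X Y ∧ X.card = t / 2 ∧ Y.card = t - t / 2 ∧
      (∀ u ∈ X, ∀ w ∈ Y, G.Adj u w) ∧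
      Set.InjOn x X ∧ Set.InjOn x Y ∧
      M.Indep (x '' X) ∧ M.Indep (x '' Y)) ∧
    (t : ℕ∞) + 2 ≤ 2 * matroidRank M := by
  have hp0 : Nonempty (HomK2 G) := ⟨⟨({a}, {b}), Set.singleton_nonempty _,
    Set.singleton_nonempty _, by simpa using hab.ne, by simpa using hab⟩⟩
  have hfin : ∀ S : Set V, M.IsRkFinite (x '' S) := fun S =>
    M.isRkFinite_of_finite ((Set.toFinite S).image x)
  have hnot : ∀ p : HomK2 G, ∀ v ∈ p.1.1, x v ∉ M.closure (x '' p.1.2) := by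
    intro p v hv h
    refine hind v (M.closure_subset_closure (Set.image_mono ?_) h)
    intro w hw
    exact p.2.2.2.2 v hv w hw
  obtain ⟨p, h1, h2⟩ := exists_large_pair G (fun S => (M.eRk (x '' S)).toNat)
    (fun S => M.closure (x '' S))
    (fun S T h => ENat.toNat_le_toNat (M.eRk_mono (Set.image_mono h)) (hfin T).eRk_lt_top.ne)
    (by
      intro S T hST h
      refine (hfin S).closure_eq_closure_of_subset_of_eRk_ge_eRk (Set.image_mono hST) ?_
      rw [← ENat.natCast_toNat (hfin S).eRk_lt_top.ne, ← ENat.natCast_toNat (hfin T).eRk_lt_top.ne]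
      exact_mod_cast h.ge)
    (by
      intro p h
      obtain ⟨v, hv⟩ := p.2.1
      refine hnot p v hv ?_
      have h' : M.closure (x '' p.1.1) = M.closure (x '' p.1.2) := h
      rw [← h']
      exact M.mem_closure_of_mem' (Set.mem_image_of_mem x hv) (hxE v))
    (by
      intro p
      obtain ⟨v, hv⟩ := p.2.1
      by_contra hlt
      have h0 : (M.eRk (x '' p.1.1)).toNat = 0 := by omega
      have h0' : M.eRk (x '' p.1.1) = 0 := by
        rw [← ENat.natCast_toNat (hfin p.1.1).eRk_lt_top.ne, h0]; rfl
      rw [Matroid.eRk_eq_zero_iff (by rintro _ ⟨u, -, rfl⟩; exact hxE u)] at h0'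
      exact hnot p v hv (M.closure_subset_closure (Set.empty_subset _)
        (h0' (Set.mem_image_of_mem x hv)))) t ht
  obtain ⟨X, hXp, hXc, hXi, hXI⟩ := exists_indep_subset M x _ _ h1
  obtain ⟨Y, hYp, hYc, hYi, hYI⟩ := exists_indep_subset M x _ _ h2
  refine ⟨⟨X, Y, ?_, hXc, hYc, ?_, hXi, hYi, hXI, hYI⟩, ?_⟩
  · rw [← Finset.disjoint_coe]
    exact p.2.2.2.1.mono hXp hYp
  · exact fun u hu w hw => p.2.2.2.2 u (hXp hu) w (hYp hw)
  · obtain ⟨v, hv⟩ := p.2.1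
    have hvY : x v ∉ M.closure (x '' Y) := fun h =>
      hnot p v hv (M.closure_subset_closure (Set.image_mono hYp) h)
    obtain ⟨hins, hmem⟩ := (hYI.notMem_closure_iff (hxE v)).1 hvY
    have hcard : (insert (x v) (x '' (Y : Set V))).encard = ((t - t / 2 + 1 : ℕ) : ℕ∞) := by
      rw [Set.encard_insert_of_notMem hmem, hYi.encard_image, Set.encard_coe_eq_coe_finsetCard,
        hYc]
      rfl
    have hrk : ((t - t / 2 + 1 : ℕ) : ℕ∞) ≤ matroidRank M := by
      rw [← hcard]
      exact le_iSup (fun I : {I : Set α // M.Indep I} => I.1.encard) ⟨_, hins⟩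
    calc (t : ℕ∞) + 2 = ((t + 2 : ℕ) : ℕ∞) := by push_cast; rfl
      _ ≤ ((2 * (t - t / 2 + 1) : ℕ) : ℕ∞) := by
        apply Nat.cast_le.2
        omega
      _ = 2 * ((t - t / 2 + 1 : ℕ) : ℕ∞) := by push_cast; rfl
      _ ≤ 2 * matroidRank M := mul_le_mul_right hrk 2
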